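/- A binary relation ≻ on F satisfies Axioms 1, 2, 3, 5, 6 and 7 if and only if there exist a non-constant affine function u : X → ℝ and monotonic constant-linear functionals I_p, I_o : B₀(Σ) → ℝ with I_p(u∘h) ≤ I_o(u∘h) for all h ∈ F, such that for all f,g ∈ F: f ≻ g iff both I_p(u∘f) > I_p(u∘g) and I_o(u∘f) > I_o(u∘g). Moreover, in this case u is unique up to positive affine transformation and the pair (I_p, I_o) is unique. -/

import Mathlib

/-!
Framework: Anscombe–Aumann acts, finitely additive probability measures,
simple acts, hope-and-prepare preferences (Bastianello–Hill style setup).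
-/

open Set

section Framework

variable (S : Type*) [MeasurableSpace S]

/-- The measurable sets (events) of `S`, as a subtype. -/
abbrev MSet := {A : Set S // MeasurableSet A}

/-- Finitely additive probability measures on `(S, Σ)`, viewed as real-valued
set functions on events.  The weak* topology is the topology of pointwise
convergence on events, i.e. the product topology on `MSet S → ℝ`. -/
def ProbCharges : Set (MSet S → ℝ) :=
  {p | (∀ A, 0 ≤ p A) ∧ p ⟨Set.univ, MeasurableSet.univ⟩ = 1 ∧
    ∀ A B : MSet S, Disjoint A.1 B.1 → p ⟨A.1 ∪ B.1, A.2.union B.2⟩ = p A + p B}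

end Framework

section Fns

variable {S : Type*} [MeasurableSpace S]

/-- `φ : S → ℝ` is a measurable simple function (an element of `B₀(Σ)`). -/
def IsSimpleFn (φ : S → ℝ) : Prop :=
  (Set.range φ).Finite ∧ ∀ y : ℝ, MeasurableSet (φ ⁻¹' {y})

/-- The integral `∫ φ dp` of a simple function `φ` against a finitely additive
measure `p` (junk value `0` if `φ` is not simple). -/
noncomputable def fInt (p : MSet S → ℝ) (φ : S → ℝ) : ℝ :=
  @dite _ (IsSimpleFn φ) (Classical.dec _)
    (fun h => ∑ y ∈ h.1.toFinset, y * p ⟨φ ⁻¹' {y}, h.2 y⟩) (fun _ => 0)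

/-- A functional `I : B₀(Σ) → ℝ` is monotonic. -/
def MonotonicFn (I : (S → ℝ) → ℝ) : Prop :=
  ∀ φ ψ, IsSimpleFn φ → IsSimpleFn ψ → (∀ s, φ s ≤ ψ s) → I φ ≤ I ψ

/-- A functional `I : B₀(Σ) → ℝ` is constant-linear: `I(aφ + b) = a I(φ) + b`
for `a ≥ 0`, `b ∈ ℝ`. -/
def ConstLinearFn (I : (S → ℝ) → ℝ) : Prop :=
  ∀ φ, IsSimpleFn φ → ∀ a : ℝ, 0 ≤ a → ∀ b : ℝ,
    I (fun s => a * φ s + b) = a * I φ + b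

end Fns

section Acts

variable {S : Type*} [MeasurableSpace S] {V : Type*} [AddCommGroup V] [Module ℝ V]

/-- `f : S → V` is a simple act with outcomes in `X`: it is `X`-valued,
takes finitely many values and is `Σ`-measurable. -/
def IsAct (X : Set V) (f : S → V) : Prop :=
  (∀ s, f s ∈ X) ∧ (Set.range f).Finite ∧ ∀ v : V, MeasurableSet (f ⁻¹' {v})

/-- Pointwise mixture `αf + (1-α)g` of two acts. -/
def mixAct (α : ℝ) (f g : S → V) : S → V := fun s => α • f s + (1 - α) • g s

/-- The constant act with outcome `x`. -/
def constAct (S : Type*) {V : Type*} (x : V) : S → V := fun _ => x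

/-- `u : V → ℝ` is affine on the convex set `X`. -/
def IsAffineOn (u : V → ℝ) (X : Set V) : Prop :=
  ∀ x ∈ X, ∀ y ∈ X, ∀ α : ℝ, 0 ≤ α → α ≤ 1 →
    u (α • x + (1 - α) • y) = α * u x + (1 - α) * u y

/-- `u` is non-constant on `X`. -/
def NonConstOn (u : V → ℝ) (X : Set V) : Prop := ∃ x ∈ X, ∃ y ∈ X, u x ≠ u y

/-- Expected utility `∫ u(f) dp` of the act `f` under the measure `p`. -/
noncomputable def EU (u : V → ℝ) (f : S → V) (p : MSet S → ℝ) : ℝ :=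
  fInt p (fun s => u (f s))

/-- Worst-case expected utility of `f` over the set of scenarios `C`. -/
noncomputable def minEU (u : V → ℝ) (C : Set (MSet S → ℝ)) (f : S → V) : ℝ :=
  sInf (EU u f '' C)

/-- Best-case expected utility of `f` over the set of scenarios `D`. -/
noncomputable def maxEU (u : V → ℝ) (D : Set (MSet S → ℝ)) (f : S → V) : ℝ :=
  sSup (EU u f '' D)

/-- `f` and `g` are incomparable (`f ⋈ g`). -/
def Incomp (R : (S → V) → (S → V) → Prop) (f g : S → V) : Prop := ¬ R f g ∧ ¬ R g f

end Acts

section Axioms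

variable {S : Type*} [MeasurableSpace S] {V : Type*} [AddCommGroup V] [Module ℝ V]
variable (X : Set V) (R : (S → V) → (S → V) → Prop)

/-- Axiom 1: `≻` is asymmetric and transitive on acts, and its restriction to
constant acts is non-trivial and negatively transitive. -/
def PrefAx1 : Prop :=
  (∀ f g, IsAct X f → IsAct X g → R f g → ¬ R g f) ∧
  (∀ f g h, IsAct X f → IsAct X g → IsAct X h → R f g → R g h → R f h) ∧
  (∃ x ∈ X, ∃ y ∈ X, R (constAct S x) (constAct S y)) ∧
  (∀ x ∈ X, ∀ y ∈ X, ∀ z ∈ X, ¬ R (constAct S x) (constAct S y) →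
    ¬ R (constAct S y) (constAct S z) → ¬ R (constAct S x) (constAct S z))

/-- Axiom 2 (continuity). -/
def PrefAx2 : Prop :=
  ∀ f g h, IsAct X f → IsAct X g → IsAct X h →
    IsOpen {α : Set.Icc (0 : ℝ) 1 | R (mixAct (α : ℝ) f g) h} ∧
    IsOpen {α : Set.Icc (0 : ℝ) 1 | R h (mixAct (α : ℝ) f g)}

/-- Axiom 3 (certainty independence). -/
def PrefAx3 : Prop :=
  ∀ f g, IsAct X f → IsAct X g → ∀ x ∈ X, ∀ α : ℝ, 0 < α → α < 1 →
    (R f g ↔ R (mixAct α f (constAct S x)) (mixAct α g (constAct S x)))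

/-- Axiom 4: for any outcome `x`, the upper and lower contour sets at the
constant act `x` are convex. -/
def PrefAx4 : Prop :=
  ∀ x ∈ X,
    (∀ f g, IsAct X f → IsAct X g → R f (constAct S x) → R g (constAct S x) →
      ∀ α : ℝ, 0 ≤ α → α ≤ 1 → R (mixAct α f g) (constAct S x)) ∧
    (∀ f g, IsAct X f → IsAct X g → R (constAct S x) f → R (constAct S x) g →
      ∀ α : ℝ, 0 ≤ α → α ≤ 1 → R (constAct S x) (mixAct α f g))

/-- Axiom 5 (monotonicity). -/
def PrefAx5 : Prop :=
  ∀ f g, IsAct X f → IsAct X g →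
    (∀ s : S, R (constAct S (f s)) (constAct S (g s))) → R f g

/-- Axiom 6: if every outcome incomparable to `f` is incomparable to `g`,
then `f` and `g` are incomparable. -/
def PrefAx6 : Prop :=
  ∀ f g, IsAct X f → IsAct X g →
    (∀ x ∈ X, Incomp R f (constAct S x) → Incomp R g (constAct S x)) → Incomp R f g

/-- Axiom 7: if `f ⋈ x`, `x ≻ g`, `g ⋈ y` and `f ≻ y`, then `f ≻ g`. -/
def PrefAx7 : Prop :=
  ∀ f g, IsAct X f → IsAct X g → ∀ x ∈ X, ∀ y ∈ X,
    Incomp R f (constAct S x) → R (constAct S x) g →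
    Incomp R g (constAct S y) → R f (constAct S y) → R f g

end Axioms

section Reps

variable {S : Type*} [MeasurableSpace S] {V : Type*} [AddCommGroup V] [Module ℝ V]

/-- `(u, C, D)` is a hope-and-prepare representation of `R`. -/
def IsHPRep (X : Set V) (R : (S → V) → (S → V) → Prop) (u : V → ℝ)
    (C D : Set (MSet S → ℝ)) : Prop :=
  IsAffineOn u X ∧ NonConstOn u X ∧
  C.Nonempty ∧ D.Nonempty ∧ C ⊆ ProbCharges S ∧ D ⊆ ProbCharges S ∧
  IsCompact C ∧ IsCompact D ∧ Convex ℝ C ∧ Convex ℝ D ∧ (C ∩ D).Nonempty ∧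
  ∀ f g, IsAct X f → IsAct X g →
    (R f g ↔ (minEU u C g < minEU u C f ∧ maxEU u D g < maxEU u D f))

/-- `(u, C)` is a Bewley representation of `R`. -/
def IsBewleyRep (X : Set V) (R : (S → V) → (S → V) → Prop) (u : V → ℝ)
    (C : Set (MSet S → ℝ)) : Prop :=
  IsAffineOn u X ∧ NonConstOn u X ∧
  C.Nonempty ∧ C ⊆ ProbCharges S ∧ IsCompact C ∧ Convex ℝ C ∧
  ∀ f g, IsAct X f → IsAct X g → (R f g ↔ ∀ p ∈ C, EU u g p < EU u f p)

/-- `(u, C, D)` is a twofold multi-prior representation of `R`. -/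
def IsTwofoldRep (X : Set V) (R : (S → V) → (S → V) → Prop) (u : V → ℝ)
    (C D : Set (MSet S → ℝ)) : Prop :=
  IsAffineOn u X ∧ NonConstOn u X ∧
  C.Nonempty ∧ D.Nonempty ∧ C ⊆ ProbCharges S ∧ D ⊆ ProbCharges S ∧
  IsCompact C ∧ IsCompact D ∧ Convex ℝ C ∧ Convex ℝ D ∧ (C ∩ D).Nonempty ∧
  ∀ f g, IsAct X f → IsAct X g → (R f g ↔ maxEU u D g < minEU u C f)

end Reps

section Statement

variable {S : Type*} [MeasurableSpace S] [Nonempty S]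
variable {V : Type*} [AddCommGroup V] [Module ℝ V]

/-- `(u, Ip, Io)` is a dual (pessimistic/optimistic) representation of `R`:
`u` is non-constant affine, `Ip` and `Io` are monotonic constant-linear
functionals on `B₀(Σ)` with `Ip(u∘h) ≤ Io(u∘h)` for every act `h`, and
`f ≻ g` iff both `Ip(u∘f) > Ip(u∘g)` and `Io(u∘f) > Io(u∘g)`. -/
def IsDualRep (X : Set V) (R : (S → V) → (S → V) → Prop) (u : V → ℝ)
    (Ip Io : (S → ℝ) → ℝ) : Prop :=
  IsAffineOn u X ∧ NonConstOn u X ∧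
  MonotonicFn Ip ∧ MonotonicFn Io ∧ ConstLinearFn Ip ∧ ConstLinearFn Io ∧
  (∀ h, IsAct X h → Ip (fun s => u (h s)) ≤ Io (fun s => u (h s))) ∧
  ∀ f g, IsAct X f → IsAct X g →
    (R f g ↔ (Ip (fun s => u (g s)) < Ip (fun s => u (f s)) ∧
      Io (fun s => u (g s)) < Io (fun s => u (f s))))

end Statement

section SimpleFunctions

variable {S : Type*} [MeasurableSpace S]

theorem finite_measurable_map₂ {A B W : Type*} {f : S → A} {g : S → B}
    (hf : (Set.range f).Finite ∧ ∀ a, MeasurableSet (f ⁻¹' {a}))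
    (hg : (Set.range g).Finite ∧ ∀ b, MeasurableSet (g ⁻¹' {b})) (k : A → B → W) :
    (Set.range fun s => k (f s) (g s)).Finite ∧
      ∀ w, MeasurableSet ((fun s => k (f s) (g s)) ⁻¹' {w}) := by
  constructor
  · refine (hf.1.image2 k hg.1).subset ?_
    rintro _ ⟨s, rfl⟩
    exact ⟨f s, ⟨s, rfl⟩, g s, ⟨s, rfl⟩, rfl⟩
  · intro w
    have h : (fun s => k (f s) (g s)) ⁻¹' {w} =
        ⋃ a ∈ Set.range f, ⋃ b ∈ Set.range g, {s | f s = a ∧ g s = b ∧ k a b = w} := by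
      ext s
      simp only [mem_preimage, mem_singleton_iff, mem_iUnion, exists_prop, mem_ofPred_eq]
      constructor
      · intro h
        exact ⟨f s, ⟨s, rfl⟩, g s, ⟨s, rfl⟩, rfl, rfl, h⟩
      · rintro ⟨a, -, b, -, h1, h2, h⟩
        rw [h1, h2, h]
    rw [h]
    refine hf.1.measurableSet_biUnion fun a _ => hg.1.measurableSet_biUnion fun b _ => ?_
    by_cases hk : k a b = w
    · have : {s | f s = a ∧ g s = b ∧ k a b = w} = f ⁻¹' {a} ∩ g ⁻¹' {b} := by
        ext s
        simp [hk]
      rw [this]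
      exact (hf.2 a).inter (hg.2 b)
    · simp [hk]

theorem finite_measurable_comp {A W : Type*} {f : S → A}
    (hf : (Set.range f).Finite ∧ ∀ a, MeasurableSet (f ⁻¹' {a})) (k : A → W) :
    (Set.range fun s => k (f s)).Finite ∧
      ∀ w, MeasurableSet ((fun s => k (f s)) ⁻¹' {w}) :=
  finite_measurable_map₂ hf hf fun a _ => k a

theorem isSimpleFn_const (b : ℝ) : IsSimpleFn (fun _ : S => b) := by
  refine ⟨Set.finite_range_const, fun y => ?_⟩
  by_cases h : b = y <;> simp [h]

theorem IsSimpleFn.affine {φ : S → ℝ} (hφ : IsSimpleFn φ) (a b : ℝ) :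
    IsSimpleFn fun s => a * φ s + b :=
  finite_measurable_comp hφ fun x => a * x + b

theorem IsSimpleFn.neg {φ : S → ℝ} (hφ : IsSimpleFn φ) : IsSimpleFn fun s => -φ s :=
  finite_measurable_comp hφ fun x => -x

theorem IsSimpleFn.exists_abs_le {φ : S → ℝ} (hφ : IsSimpleFn φ) :
    ∃ M : ℝ, 0 ≤ M ∧ ∀ s, |φ s| ≤ M := by
  have h := (finite_measurable_comp hφ fun x => |x|).1.bddAbove
  obtain ⟨M, hM⟩ := h
  exact ⟨max M 0, le_max_right _ _, fun s => (hM ⟨s, rfl⟩).trans (le_max_left _ _)⟩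

theorem ConstLinearFn.const {I : (S → ℝ) → ℝ} (hI : ConstLinearFn I) (b : ℝ) :
    I (fun _ => b) = b := by
  have := hI _ (isSimpleFn_const 0) 0 le_rfl b
  simpa using this

theorem continuous_mix_of_monotonicFn {I : (S → ℝ) → ℝ} (hm : MonotonicFn I)
    (hc : ConstLinearFn I) {φ ψ : S → ℝ} (hφ : IsSimpleFn φ) (hψ : IsSimpleFn ψ) :
    Continuous fun α : ℝ => I fun s => α * φ s + (1 - α) * ψ s := by
  have hd : IsSimpleFn fun s => φ s - ψ s := finite_measurable_map₂ hφ hψ fun x y => x - y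
  obtain ⟨M, hM0, hM⟩ := hd.exists_abs_le
  have hs : ∀ α : ℝ, IsSimpleFn fun s => α * φ s + (1 - α) * ψ s := fun α =>
    finite_measurable_map₂ hφ hψ fun x y => α * x + (1 - α) * y
  refine (LipschitzWith.of_le_add_mul ⟨M, hM0⟩ fun α β => ?_).continuous
  have h1 := hc _ (hs β) 1 zero_le_one (M * dist α β)
  rw [one_mul] at h1
  change _ ≤ _ + M * dist α β
  rw [← h1]
  refine hm _ _ (hs α) ((hs β).affine 1 _) fun s => ?_
  have h2 : (α - β) * (φ s - ψ s) ≤ |α - β| * M :=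
    (le_abs_self _).trans (by rw [abs_mul]; gcongr; exact hM s)
  rw [Real.dist_eq]
  linarith

end SimpleFunctions

section Thresholds

variable {S : Type*} [MeasurableSpace S]

/-- A strict preference between simple functions which is invariant under common positive affine
transformations, monotone and continuous has certainty equivalents from below. -/
theorem exists_threshold (Q : (S → ℝ) → (S → ℝ) → Prop)
    (hasymm : ∀ φ ψ, IsSimpleFn φ → IsSimpleFn ψ → Q φ ψ → ¬ Q ψ φ)
    (htrans : ∀ φ ψ χ, IsSimpleFn φ → IsSimpleFn ψ → IsSimpleFn χ → Q φ ψ → Q ψ χ → Q φ χ)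
    (hdom : ∀ φ ψ, IsSimpleFn φ → IsSimpleFn ψ → (∀ s, ψ s < φ s) → Q φ ψ)
    (haff : ∀ φ ψ, IsSimpleFn φ → IsSimpleFn ψ → ∀ a : ℝ, 0 < a → ∀ b : ℝ, Q φ ψ →
      Q (fun s => a * φ s + b) (fun s => a * ψ s + b))
    (hcont : ∀ φ ψ, IsSimpleFn φ → IsSimpleFn ψ → Q φ ψ →
      ∃ ε > 0, Q (fun s => φ s - ε) ψ) :
    ∃ I : (S → ℝ) → ℝ, MonotonicFn I ∧ ConstLinearFn I ∧
      ∀ φ, IsSimpleFn φ → ∀ t : ℝ, Q φ (fun _ => t) ↔ t < I φ := by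
  have key : ∀ φ, IsSimpleFn φ → ∃ r : ℝ, ∀ t : ℝ, Q φ (fun _ => t) ↔ t < r := by
    intro φ hφ
    obtain ⟨M, -, hM⟩ := hφ.exists_abs_le
    have hne : {t : ℝ | Q φ fun _ => t}.Nonempty := by
      refine ⟨-M - 1, hdom _ _ hφ (isSimpleFn_const _) fun s => ?_⟩
      linarith [(abs_le.1 (hM s)).1]
    have hdown : ∀ t t' : ℝ, Q φ (fun _ => t) → t' < t → Q φ fun _ => t' := fun t t' h ht =>
      htrans _ _ _ hφ (isSimpleFn_const _) (isSimpleFn_const _) h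
        (hdom _ _ (isSimpleFn_const _) (isSimpleFn_const _) fun _ => ht)
    have hbdd : BddAbove {t : ℝ | Q φ fun _ => t} := by
      refine ⟨M + 1, fun t ht => ?_⟩
      by_contra! hlt
      refine hasymm _ _ hφ (isSimpleFn_const _) ht (hdom _ _ (isSimpleFn_const _) hφ fun s => ?_)
      linarith [(abs_le.1 (hM s)).2]
    have hup : ∀ t : ℝ, Q φ (fun _ => t) → ∃ t' > t, Q φ fun _ => t' := by
      intro t ht
      obtain ⟨ε, hε, h⟩ := hcont _ _ hφ (isSimpleFn_const _) ht
      refine ⟨t + ε, by linarith, ?_⟩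
      have hs : IsSimpleFn fun s => φ s - ε := finite_measurable_comp hφ fun x => x - ε
      have := haff _ _ hs (isSimpleFn_const _) 1 one_pos ε h
      simpa using this
    refine ⟨sSup {t : ℝ | Q φ fun _ => t}, fun t => ⟨fun ht => ?_, fun ht => ?_⟩⟩
    · obtain ⟨t', htt', h⟩ := hup t ht
      exact htt'.trans_le (le_csSup hbdd h)
    · obtain ⟨t', h, htt'⟩ := exists_lt_of_lt_csSup hne ht
      exact hdown _ _ h htt'
  choose! I hI using key
  refine ⟨I, ?_, ?_, hI⟩
  · intro φ ψ hφ hψ hle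
    refine le_of_forall_lt fun t ht => (hI ψ hψ t).1 ?_
    obtain ⟨ε, hε, h⟩ := hcont _ _ hφ (isSimpleFn_const _) ((hI φ hφ t).2 ht)
    have hs : IsSimpleFn fun s => φ s - ε := finite_measurable_comp hφ fun x => x - ε
    exact htrans _ _ _ hψ hs (isSimpleFn_const _)
      (hdom _ _ hψ hs fun s => by linarith [hle s]) h
  · intro φ hφ a ha b
    rcases ha.eq_or_lt with rfl | ha
    · have hs := isSimpleFn_const (S := S) b
      have h : I (fun _ => b) = b := by
        refine eq_of_forall_lt_iff fun t => ?_
        rw [← hI _ hs]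
        refine ⟨fun h => ?_, fun h => hdom _ _ hs (isSimpleFn_const _) fun _ => h⟩
        by_contra! hbt
        rcases hbt.eq_or_lt with rfl | hbt
        · exact hasymm _ _ hs hs h h
        · exact hasymm _ _ hs (isSimpleFn_const _) h (hdom _ _ (isSimpleFn_const _) hs fun _ => hbt)
      simpa using h
    · refine eq_of_forall_lt_iff fun t => ?_
      rw [← hI _ (hφ.affine a b)]
      have h1 : t < a * I φ + b ↔ (t - b) / a < I φ := by
        rw [div_lt_iff₀ ha]
        constructor <;> intro h <;> linarith
      rw [h1, ← hI _ hφ]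
      constructor
      · intro h
        have := haff _ _ (hφ.affine a b) (isSimpleFn_const _) a⁻¹ (inv_pos.2 ha) (-(b / a)) h
        convert this using 2
        · field_simp
          ring
        · field_simp
          ring
      · intro h
        have := haff _ _ hφ (isSimpleFn_const _) a ha b h
        convert this using 2
        field_simp
        ring

theorem exists_dual_functionals (Q : (S → ℝ) → (S → ℝ) → Prop)
    (hasymm : ∀ φ ψ, IsSimpleFn φ → IsSimpleFn ψ → Q φ ψ → ¬ Q ψ φ)
    (htrans : ∀ φ ψ χ, IsSimpleFn φ → IsSimpleFn ψ → IsSimpleFn χ → Q φ ψ → Q ψ χ → Q φ χ)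
    (hdom : ∀ φ ψ, IsSimpleFn φ → IsSimpleFn ψ → (∀ s, ψ s < φ s) → Q φ ψ)
    (haff : ∀ φ ψ, IsSimpleFn φ → IsSimpleFn ψ → ∀ a : ℝ, 0 < a → ∀ b : ℝ, Q φ ψ →
      Q (fun s => a * φ s + b) (fun s => a * ψ s + b))
    (hcont : ∀ φ ψ, IsSimpleFn φ → IsSimpleFn ψ → Q φ ψ →
      ∃ ε > 0, Q (fun s => φ s - ε) ψ)
    (hincomp : ∀ φ ψ, IsSimpleFn φ → IsSimpleFn ψ →
      (∀ t : ℝ, ¬ Q φ (fun _ => t) ∧ ¬ Q (fun _ => t) φ →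
        ¬ Q ψ (fun _ => t) ∧ ¬ Q (fun _ => t) ψ) → ¬ Q φ ψ ∧ ¬ Q ψ φ)
    (hcross : ∀ φ ψ, IsSimpleFn φ → IsSimpleFn ψ → ∀ t r : ℝ,
      ¬ Q φ (fun _ => t) ∧ ¬ Q (fun _ => t) φ → Q (fun _ => t) ψ →
      ¬ Q ψ (fun _ => r) ∧ ¬ Q (fun _ => r) ψ → Q φ (fun _ => r) → Q φ ψ) :
    ∃ Ip Io : (S → ℝ) → ℝ, MonotonicFn Ip ∧ MonotonicFn Io ∧ ConstLinearFn Ip ∧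
      ConstLinearFn Io ∧ (∀ φ, IsSimpleFn φ → Ip φ ≤ Io φ) ∧
      ∀ φ ψ, IsSimpleFn φ → IsSimpleFn ψ → (Q φ ψ ↔ Ip ψ < Ip φ ∧ Io ψ < Io φ) := by
  obtain ⟨Ip, hpm, hpc, hp⟩ := exists_threshold Q hasymm htrans hdom haff hcont
  obtain ⟨J, hJm, hJc, hJ⟩ := exists_threshold
    (fun φ ψ => Q (fun s => -ψ s) (fun s => -φ s))
    (fun φ ψ hφ hψ h => hasymm _ _ hψ.neg hφ.neg h)
    (fun φ ψ χ hφ hψ hχ h h' => htrans _ _ _ hχ.neg hψ.neg hφ.neg h' h)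
    (fun φ ψ hφ hψ h => hdom _ _ hψ.neg hφ.neg fun s => neg_lt_neg (h s))
    (fun φ ψ hφ hψ a ha b h => by
      convert haff _ _ hψ.neg hφ.neg a ha (-b) h using 2 <;> ring)
    (fun φ ψ hφ hψ h => by
      obtain ⟨ε, hε, h⟩ := hcont _ _ hψ.neg hφ.neg h
      have hs : IsSimpleFn fun s => -ψ s - ε := finite_measurable_comp hψ fun x => -x - ε
      refine ⟨ε, hε, ?_⟩
      convert haff _ _ hs hφ.neg 1 one_pos ε h using 2 <;> ring)
  have ho : ∀ φ, IsSimpleFn φ → ∀ t : ℝ, Q (fun _ => t) φ ↔ -J (fun s => -φ s) < t := by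
    intro φ hφ t
    have := hJ _ hφ.neg (-t)
    simp only [neg_neg] at this
    rw [this]
    exact neg_lt
  have hle : ∀ φ, IsSimpleFn φ → Ip φ ≤ -J (fun s => -φ s) := by
    intro φ hφ
    by_contra! hlt
    obtain ⟨t, h1, h2⟩ := exists_between hlt
    exact hasymm _ _ hφ (isSimpleFn_const _) ((hp _ hφ t).2 h2) ((ho _ hφ t).2 h1)
  refine ⟨Ip, fun φ => -J (fun s => -φ s), hpm, ?_, hpc, ?_, hle, ?_⟩
  · intro φ ψ hφ hψ h
    exact neg_le_neg (hJm _ _ hψ.neg hφ.neg fun s => neg_le_neg (h s))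
  · intro φ hφ a ha b
    have := hJc _ hφ.neg a ha (-b)
    have h2 : (fun s => -(a * φ s + b)) = fun s => a * -φ s + -b := by
      ext s
      ring
    simp only [h2, this]
    ring
  · intro φ ψ hφ hψ
    constructor
    · intro h
      have h1 : Ip ψ ≤ Ip φ := le_of_forall_lt fun t ht => (hp φ hφ t).1
        (htrans _ _ _ hφ hψ (isSimpleFn_const _) h ((hp ψ hψ t).2 ht))
      have h2 : -J (fun s => -ψ s) ≤ -J (fun s => -φ s) := le_of_forall_gt fun t ht =>
        (ho ψ hψ t).1 (htrans _ _ _ (isSimpleFn_const _) hφ hψ ((ho φ hφ t).2 ht) h)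
      refine ⟨h1.lt_of_ne fun heq => ?_, h2.lt_of_ne fun heq => ?_⟩
      · refine (hincomp ψ φ hψ hφ fun t ht => ?_).2 h
        rw [hp _ hψ, ho _ hψ] at ht
        rw [hp _ hφ, ho _ hφ]
        exact ⟨by linarith [ht.1], by linarith [ht.2]⟩
      · refine (hincomp φ ψ hφ hψ fun t ht => ?_).1 h
        rw [hp _ hφ, ho _ hφ] at ht
        rw [hp _ hψ, ho _ hψ]
        exact ⟨by linarith [ht.1], by linarith [ht.2]⟩
    · rintro ⟨h1, h2⟩
      refine hcross φ ψ hφ hψ (-J fun s => -φ s) (Ip ψ) ?_ ?_ ?_ ?_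
      · rw [hp _ hφ, ho _ hφ]
        exact ⟨(hle φ hφ).not_gt, lt_irrefl _⟩
      · rwa [ho _ hψ]
      · rw [hp _ hψ, ho _ hψ]
        exact ⟨lt_irrefl _, (hle ψ hψ).not_gt⟩
      · rwa [hp _ hφ]

end Thresholds

section ConstantActs

variable {S : Type*} [MeasurableSpace S]
variable {V : Type*}

theorem IsAct.isSimpleFn {X : Set V} {f : S → V} (hf : IsAct X f) (u : V → ℝ) :
    IsSimpleFn fun s => u (f s) :=
  finite_measurable_comp hf.2 u

theorem isAct_constAct {X : Set V} {x : V} (hx : x ∈ X) : IsAct X (constAct S x) := by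
  refine ⟨fun _ => hx, Set.finite_range_const, fun v => ?_⟩
  by_cases h : x = v
  · simp [constAct, Set.preimage, h]
  · simp [constAct, Set.preimage, h]

end ConstantActs

section Utility

variable {V : Type*} [AddCommGroup V] [Module ℝ V]

theorem exists_forall_le_of_isOpen_Icc {p : ℝ → Prop}
    (ho : IsOpen {α : Set.Icc (0 : ℝ) 1 | p α}) (h0 : p 0) :
    ∃ δ : ℝ, 0 < δ ∧ δ < 1 ∧ ∀ c, 0 ≤ c → c ≤ δ → p c := by
  obtain ⟨ε, hε, h⟩ := Metric.isOpen_iff.1 ho ⟨0, by simp⟩ h0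
  refine ⟨min (ε / 2) (1 / 2), by positivity, ?_, fun c hc0 hc => ?_⟩
  · exact (min_le_right _ _).trans_lt (by norm_num)
  · have hc1 : c ≤ 1 / 2 := hc.trans (min_le_right _ _)
    have hc2 : c ≤ ε / 2 := hc.trans (min_le_left _ _)
    have hmem : (⟨c, hc0, by linarith⟩ : Set.Icc (0 : ℝ) 1) ∈
        Metric.ball (⟨0, by simp⟩ : Set.Icc (0 : ℝ) 1) ε := by
      rw [Metric.mem_ball, Subtype.dist_eq, Real.dist_eq]
      simp only [sub_zero]
      rw [abs_of_nonneg hc0]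
      linarith
    exact h hmem

/-- The point at position `t` of the segment from `x₀` (at `t = -1`) to `x₁` (at `t = 1`). -/
noncomputable def segPoint (x₀ x₁ : V) (t : ℝ) : V :=
  ((1 + t) / 2) • x₁ + (1 - (1 + t) / 2) • x₀

theorem segPoint_mem {X : Set V} (hX : Convex ℝ X) {x₀ x₁ : V} (h₀ : x₀ ∈ X) (h₁ : x₁ ∈ X)
    {t : ℝ} (ht : |t| ≤ 1) : segPoint x₀ x₁ t ∈ X := by
  obtain ⟨h1, h2⟩ := abs_le.1 ht
  exact hX h₁ h₀ (by linarith) (by linarith) (by ring)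

theorem segPoint_mix (x₀ x₁ : V) (α s t : ℝ) :
    α • segPoint x₀ x₁ s + (1 - α) • segPoint x₀ x₁ t =
      segPoint x₀ x₁ (α * s + (1 - α) * t) := by
  simp only [segPoint]
  module

theorem segPoint_one (x₀ x₁ : V) : segPoint x₀ x₁ 1 = x₁ := by
  simp [segPoint]

theorem segPoint_neg_one (x₀ x₁ : V) : segPoint x₀ x₁ (-1) = x₀ := by
  simp [segPoint]

/-- The mixture space theorem of Herstein and Milnor on a convex set. -/
theorem exists_affine_utility {X : Set V} (hX : Convex ℝ X) (P : V → V → Prop)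
    (hasymm : ∀ x ∈ X, ∀ y ∈ X, P x y → ¬ P y x)
    (hneg : ∀ x ∈ X, ∀ y ∈ X, ∀ z ∈ X, ¬ P x y → ¬ P y z → ¬ P x z)
    (hind : ∀ x ∈ X, ∀ y ∈ X, ∀ z ∈ X, ∀ α : ℝ, 0 < α → α < 1 →
      (P x y ↔ P (α • x + (1 - α) • z) (α • y + (1 - α) • z)))
    (hcont : ∀ x ∈ X, ∀ y ∈ X, ∀ z ∈ X,
      IsOpen {α : Set.Icc (0 : ℝ) 1 | P ((α : ℝ) • x + (1 - (α : ℝ)) • y) z} ∧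
      IsOpen {α : Set.Icc (0 : ℝ) 1 | P z ((α : ℝ) • x + (1 - (α : ℝ)) • y)})
    {x₀ x₁ : V} (h₀ : x₀ ∈ X) (h₁ : x₁ ∈ X) (h₁₀ : P x₁ x₀) :
    ∃ u : V → ℝ, IsAffineOn u X ∧ ∀ x ∈ X, ∀ y ∈ X, (P x y ↔ u y < u x) := by
  set w := segPoint x₀ x₁ with hw
  have hwX : ∀ t, |t| ≤ 1 → w t ∈ X := fun t ht => segPoint_mem hX h₀ h₁ ht
  have hmX : ∀ x ∈ X, ∀ y ∈ X, ∀ α : ℝ, 0 ≤ α → α ≤ 1 → α • x + (1 - α) • y ∈ X :=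
    fun x hx y hy α ha hb => hX hx hy ha (by linarith) (by ring)
  have hindle : ∀ x ∈ X, ∀ y ∈ X, ∀ z ∈ X, ∀ α : ℝ, 0 < α → α ≤ 1 →
      (P x y ↔ P (α • x + (1 - α) • z) (α • y + (1 - α) • z)) := by
    intro x hx y hy z hz α ha hb
    rcases hb.eq_or_lt with rfl | hb
    · simp
    · exact hind x hx y hy z hz α ha hb
  have hwlt : ∀ s t, |s| ≤ 1 → |t| ≤ 1 → t < s → P (w s) (w t) := by
    intro s t hs ht hts
    have hs' := abs_le.1 hs
    have ht' := abs_le.1 ht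
    have h1 : P (w s) (w (-1)) := by
      have := (hindle _ h₁ _ h₀ _ h₀ ((1 + s) / 2) (by linarith) (by linarith)).1 h₁₀
      convert this using 1
      · simp only [hw, segPoint]
      · rw [hw, segPoint_neg_one]
        module
    have hpos : 0 < 1 + s := by linarith
    have hγ : 0 < (s - t) / (1 + s) := div_pos (by linarith) hpos
    have hγ1 : (s - t) / (1 + s) ≤ 1 := (div_le_one hpos).2 (by linarith)
    have := (hindle _ (hwX s hs) _ (hwX (-1) (by simp)) _ (hwX s hs) _ hγ hγ1).1 h1
    rw [hw, segPoint_mix, segPoint_mix] at this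
    convert this using 2
    · ring
    · field_simp
      ring
  have hwiff : ∀ s t, |s| ≤ 1 → |t| ≤ 1 → (P (w s) (w t) ↔ t < s) := by
    intro s t hs ht
    refine ⟨fun h => ?_, hwlt s t hs ht⟩
    by_contra! hle
    rcases hle.eq_or_lt with rfl | hlt
    · exact hasymm _ (hwX _ hs) _ (hwX _ hs) h h
    · exact hasymm _ (hwX _ hs) _ (hwX _ ht) h (hwlt _ _ ht hs hlt)
  have key : ∀ x ∈ X, ∃ r c₀ : ℝ, 0 < c₀ ∧ c₀ < 1 ∧ ∀ c, 0 < c → c ≤ c₀ → |c * r| ≤ 1 ∧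
      ¬ P (c • x + (1 - c) • w 0) (w (c * r)) ∧ ¬ P (w (c * r)) (c • x + (1 - c) • w 0) := by
    intro x hx
    have hw0 := hwX 0 (by simp)
    obtain ⟨δ₁, hδ₁, hδ₁', hd₁⟩ := exists_forall_le_of_isOpen_Icc
      (p := fun c => P (c • x + (1 - c) • w 0) (w (-1)))
      (hcont x hx _ hw0 _ (hwX (-1) (by simp))).1
      (by simpa using hwlt 0 (-1) (by simp) (by simp) (by norm_num))
    obtain ⟨δ₂, hδ₂, hδ₂', hd₂⟩ := exists_forall_le_of_isOpen_Icc
      (p := fun c => P (w 1) (c • x + (1 - c) • w 0))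
      (hcont x hx _ hw0 _ (hwX 1 (by simp))).2
      (by simpa using hwlt 1 0 (by simp) (by simp) (by norm_num))
    set c₀ := min δ₁ δ₂ with hc₀
    have hpos : 0 < c₀ := lt_min hδ₁ hδ₂
    have hlt1 : c₀ < 1 := (min_le_left _ _).trans_lt hδ₁'
    have hlo := hd₁ c₀ hpos.le (min_le_left _ _)
    have hhi := hd₂ c₀ hpos.le (min_le_right _ _)
    have hxX := hmX x hx _ hw0 c₀ hpos.le hlt1.le
    set xc := c₀ • x + (1 - c₀) • w 0 with hxc
    obtain ⟨α, hα⟩ : ∃ α : Set.Icc (0 : ℝ) 1,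
        ¬ P ((α : ℝ) • x₁ + (1 - (α : ℝ)) • x₀) xc ∧
          ¬ P xc ((α : ℝ) • x₁ + (1 - (α : ℝ)) • x₀) := by
      by_contra! hcon
      have hpre : PreconnectedSpace (Set.Icc (0 : ℝ) 1) :=
        Subtype.preconnectedSpace isPreconnected_Icc
      obtain ⟨α, -, h1, h2⟩ := (isPreconnected_univ (α := Set.Icc (0 : ℝ) 1)) _ _
        (hcont _ h₁ _ h₀ _ hxX).1 (hcont _ h₁ _ h₀ _ hxX).2
        (fun α _ => by
          by_cases h : P ((α : ℝ) • x₁ + (1 - (α : ℝ)) • x₀) xc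
          · exact Or.inl h
          · exact Or.inr (hcon α h))
        ⟨⟨1, by simp⟩, trivial, by simpa [hw, segPoint_one] using hhi⟩
        ⟨⟨0, by simp⟩, trivial, by simpa [hw, segPoint_neg_one] using hlo⟩
      exact hasymm _ (hmX _ h₁ _ h₀ _ α.2.1 α.2.2) _ hxX h1 h2
    obtain ⟨⟨α, hα0, hα1⟩, hα⟩ := α, hα
    have hwα : α • x₁ + (1 - α) • x₀ = w (2 * α - 1) := by
      simp only [hw, segPoint]
      module
    simp only [hwα] at hα
    have habs : |2 * α - 1| ≤ 1 := abs_le.2 ⟨by linarith, by linarith⟩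
    refine ⟨(2 * α - 1) / c₀, c₀, hpos, hlt1, fun c hc hcc => ?_⟩
    have hβ : 0 < c / c₀ := div_pos hc hpos
    have hβ1 : c / c₀ ≤ 1 := (div_le_one hpos).2 hcc
    have heq : c * ((2 * α - 1) / c₀) = c / c₀ * (2 * α - 1) := by ring
    have h1 : c • x + (1 - c) • w 0 = (c / c₀) • xc + (1 - c / c₀) • w 0 := by
      have : c = c / c₀ * c₀ := by field_simp
      rw [hxc]
      nth_rewrite 1 2 [this]
      module
    have h2 : w (c * ((2 * α - 1) / c₀)) =
        (c / c₀) • w (2 * α - 1) + (1 - c / c₀) • w 0 := by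
      rw [hw, segPoint_mix, heq]
      simp
    refine ⟨?_, ?_⟩
    · rw [heq, abs_mul, abs_of_pos hβ]
      exact mul_le_one₀ hβ1 (abs_nonneg _) habs
    · rw [h1, h2, ← hindle _ hxX _ (hwX _ habs) _ hw0 _ hβ hβ1,
        ← hindle _ (hwX _ habs) _ hxX _ hw0 _ hβ hβ1]
      exact ⟨hα.2, hα.1⟩
  choose! u c₀ hpos hlt hu using key
  have hw0 := hwX 0 (by simp)
  refine ⟨u, ?_, ?_⟩
  · intro x hx y hy α hα0 hα1
    have hzX := hmX x hx y hy α hα0 hα1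
    rcases hα0.eq_or_lt with rfl | hα0
    · simp
    rcases hα1.eq_or_lt with rfl | hα1
    · simp
    set z := α • x + (1 - α) • y with hz
    set c := min (min (c₀ x) (c₀ y)) (c₀ z) with hc
    have hcpos : 0 < c := lt_min (lt_min (hpos x hx) (hpos y hy)) (hpos z hzX)
    have hcx : c ≤ c₀ x := (min_le_left _ _).trans (min_le_left _ _)
    have hc1 : c ≤ 1 := hcx.trans (hlt x hx).le
    obtain ⟨ax, px, qx⟩ := hu x hx c hcpos hcx
    obtain ⟨ay, py, qy⟩ := hu y hy c hcpos ((min_le_left _ _).trans (min_le_right _ _))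
    obtain ⟨az, pz, qz⟩ := hu z hzX c hcpos (min_le_right _ _)
    have hxX := hmX x hx _ hw0 c hcpos.le hc1
    have hyX := hmX y hy _ hw0 c hcpos.le hc1
    have hzcX := hmX z hzX _ hw0 c hcpos.le hc1
    have hzc : c • z + (1 - c) • w 0 =
        α • (c • x + (1 - c) • w 0) + (1 - α) • (c • y + (1 - c) • w 0) := by
      rw [hz]
      module
    set xc := c • x + (1 - c) • w 0
    set yc := c • y + (1 - c) • w 0
    have hwz : α • w (c * u x) + (1 - α) • w (c * u y) =
        w (c * (α * u x + (1 - α) * u y)) := by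
      rw [hw, segPoint_mix]
      congr 1
      ring
    have hβ0 : 0 < 1 - α := by linarith
    have hβ1 : 1 - α < 1 := by linarith
    have hmid := hmX xc hxX _ (hwX _ ay) α hα0.le hα1.le
    have habs : |c * (α * u x + (1 - α) * u y)| ≤ 1 := by
      have hx' := abs_le.1 ax
      have hy' := abs_le.1 ay
      rw [abs_le]
      constructor <;> nlinarith
    have hcomm : ∀ p q : V, (1 - α) • p + (1 - (1 - α)) • q = α • q + (1 - α) • p := by
      intro p q
      module
    rw [hzc] at pz qz hzcX
    have i1 : ¬ P (α • xc + (1 - α) • yc) (α • xc + (1 - α) • w (c * u y)) := by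
      have := (hind _ hyX _ (hwX _ ay) _ hxX _ hβ0 hβ1).not.1 py
      rwa [hcomm, hcomm] at this
    have i2 : ¬ P (α • xc + (1 - α) • w (c * u y)) (α • xc + (1 - α) • yc) := by
      have := (hind _ (hwX _ ay) _ hyX _ hxX _ hβ0 hβ1).not.1 qy
      rwa [hcomm, hcomm] at this
    have j1 := (hind _ hxX _ (hwX _ ax) _ (hwX _ ay) _ hα0 hα1).not.1 px
    have j2 := (hind _ (hwX _ ax) _ hxX _ (hwX _ ay) _ hα0 hα1).not.1 qx
    rw [hwz] at j1 j2
    have k1 := hneg _ hzcX _ hmid _ (hwX _ habs) i1 j1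
    have k2 := hneg _ (hwX _ habs) _ hmid _ hzcX j2 i2
    have l1 := hneg _ (hwX _ az) _ hzcX _ (hwX _ habs) qz k1
    have l2 := hneg _ (hwX _ habs) _ hzcX _ (hwX _ az) k2 pz
    rw [hwiff _ _ az habs, not_lt] at l1
    rw [hwiff _ _ habs az, not_lt] at l2
    exact mul_left_cancel₀ hcpos.ne' (le_antisymm l1 l2)
  · intro x hx y hy
    set c := min (c₀ x) (c₀ y) with hc
    have hcpos : 0 < c := lt_min (hpos x hx) (hpos y hy)
    have hcx : c ≤ c₀ x := min_le_left _ _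
    have hc1 : c < 1 := hcx.trans_lt (hlt x hx)
    obtain ⟨ax, px, qx⟩ := hu x hx c hcpos hcx
    obtain ⟨ay, py, qy⟩ := hu y hy c hcpos (min_le_right _ _)
    have hxX := hmX x hx _ hw0 c hcpos.le hc1.le
    have hyX := hmX y hy _ hw0 c hcpos.le hc1.le
    have hww : P (w (c * u x)) (w (c * u y)) ↔ u y < u x := by
      rw [hwiff _ _ ax ay, mul_lt_mul_iff_right₀ hcpos]
    rw [hind x hx y hy _ hw0 c hcpos hc1, ← hww, ← not_iff_not]
    constructor
    · intro h
      exact hneg _ (hwX _ ax) _ hxX _ (hwX _ ay) qx (hneg _ hxX _ hyX _ (hwX _ ay) h py)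
    · intro h
      exact hneg _ hxX _ (hwX _ ax) _ hyX px (hneg _ (hwX _ ax) _ (hwX _ ay) _ hyX h qy)

theorem IsAffineOn.exists_eq {X : Set V} (hX : Convex ℝ X) {u : V → ℝ} (hu : IsAffineOn u X)
    {x y : V} (hx : x ∈ X) (hy : y ∈ X) {t : ℝ} (hxt : u x ≤ t) (hty : t ≤ u y) :
    ∃ z ∈ X, u z = t := by
  rcases (hxt.trans hty).eq_or_lt with h | h
  · exact ⟨x, hx, by linarith⟩
  · have hd : 0 < u y - u x := by linarith
    have h0 : 0 ≤ (t - u x) / (u y - u x) := div_nonneg (by linarith) hd.le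
    have h1 : (t - u x) / (u y - u x) ≤ 1 := (div_le_one hd).2 (by linarith)
    refine ⟨_, hX hy hx h0 (sub_nonneg.2 h1) (by ring), ?_⟩
    rw [hu y hy x hx _ h0 h1]
    field_simp
    ring

end Utility

section Preferences

variable {S : Type*} [MeasurableSpace S]
variable {V : Type*} [AddCommGroup V] [Module ℝ V]

theorem IsAct.mixAct {X : Set V} (hX : Convex ℝ X) {f g : S → V} (hf : IsAct X f)
    (hg : IsAct X g) {α : ℝ} (h0 : 0 ≤ α) (h1 : α ≤ 1) : IsAct X (mixAct α f g) :=
  ⟨fun s => hX (hf.1 s) (hg.1 s) h0 (by linarith) (by ring),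
    finite_measurable_map₂ hf.2 hg.2 fun x y => α • x + (1 - α) • y⟩

theorem IsAffineOn.mixAct {X : Set V} {u : V → ℝ} (hu : IsAffineOn u X) {f g : S → V}
    (hf : IsAct X f) (hg : IsAct X g) {α : ℝ} (h0 : 0 ≤ α) (h1 : α ≤ 1) (s : S) :
    u (mixAct α f g s) = α * u (f s) + (1 - α) * u (g s) :=
  hu _ (hf.1 s) _ (hg.1 s) α h0 h1

theorem IsAffineOn.segPoint {X : Set V} {u : V → ℝ} (hu : IsAffineOn u X) {x₀ x₁ : V}
    (h₀ : x₀ ∈ X) (h₁ : x₁ ∈ X) (hu₀ : u x₀ = -1) (hu₁ : u x₁ = 1) {t : ℝ} (ht : |t| ≤ 1) :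
    u (segPoint x₀ x₁ t) = t := by
  obtain ⟨h1, h2⟩ := abs_le.1 ht
  have := hu _ h₁ _ h₀ ((1 + t) / 2) (by linarith) (by linarith)
  rw [_root_.segPoint, this, hu₀, hu₁]
  ring

theorem isAct_segPoint {X : Set V} (hX : Convex ℝ X) {x₀ x₁ : V} (h₀ : x₀ ∈ X) (h₁ : x₁ ∈ X)
    {φ : S → ℝ} (hφ : IsSimpleFn φ) {k : ℝ} (hk : 0 < k) (hb : ∀ s, |φ s| ≤ k) :
    IsAct X fun s => segPoint x₀ x₁ (φ s / k) := by
  refine ⟨fun s => segPoint_mem hX h₀ h₁ ?_, finite_measurable_comp hφ fun x => segPoint x₀ x₁ (x / k)⟩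
  rw [abs_div, abs_of_pos hk]
  exact (div_le_one hk).2 (hb s)

theorem exists_mixAct_pref {X : Set V} {R : (S → V) → (S → V) → Prop}
    (A2 : PrefAx2 X R) {f g : S → V} (hf : IsAct X f) (hg : IsAct X g) {w : V} (hw : w ∈ X)
    (h : R f g) :
    ∃ δ : ℝ, 0 < δ ∧ δ < 1 ∧ R (mixAct δ (constAct S w) f) g := by
  obtain ⟨δ, h0, h1, hδ⟩ := exists_forall_le_of_isOpen_Icc
    (p := fun c => R (mixAct c (constAct S w) f) g) (A2 _ _ _ (isAct_constAct hw) hf hg).1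
    (by rwa [show mixAct 0 (constAct S w) f = f from funext fun s => by simp [mixAct]])
  exact ⟨δ, h0, h1, hδ δ h0.le le_rfl⟩

theorem exists_pref_mixAct {X : Set V} {R : (S → V) → (S → V) → Prop}
    (A2 : PrefAx2 X R) {f g : S → V} (hf : IsAct X f) (hg : IsAct X g) {w : V} (hw : w ∈ X)
    (h : R f g) :
    ∃ δ : ℝ, 0 < δ ∧ δ < 1 ∧ R f (mixAct δ (constAct S w) g) := by
  obtain ⟨δ, h0, h1, hδ⟩ := exists_forall_le_of_isOpen_Icc
    (p := fun c => R f (mixAct c (constAct S w) g)) (A2 _ _ _ (isAct_constAct hw) hg hf).2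
    (by rwa [show mixAct 0 (constAct S w) g = g from funext fun s => by simp [mixAct]])
  exact ⟨δ, h0, h1, hδ δ h0.le le_rfl⟩

/-- The preference between two acts depends only on their utility profiles. -/
theorem pref_of_utility_eq {X : Set V} (hX : Convex ℝ X)
    {R : (S → V) → (S → V) → Prop} (A1 : PrefAx1 X R) (A2 : PrefAx2 X R) (A3 : PrefAx3 X R)
    (A5 : PrefAx5 X R) {u : V → ℝ} (hu : IsAffineOn u X)
    (huR : ∀ x ∈ X, ∀ y ∈ X, R (constAct S x) (constAct S y) ↔ u y < u x)
    {x₀ x₁ : V} (h₀ : x₀ ∈ X) (h₁ : x₁ ∈ X) (hu₀ : u x₀ = -1) (hu₁ : u x₁ = 1)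
    {f g f' g' : S → V} (hf : IsAct X f) (hg : IsAct X g) (hf' : IsAct X f') (hg' : IsAct X g')
    (hff' : ∀ s, u (f' s) = u (f s)) (hgg' : ∀ s, u (g' s) = u (g s)) (h : R f g) :
    R f' g' := by
  obtain ⟨M, hM0, hM⟩ := (hf.isSimpleFn u).exists_abs_le
  obtain ⟨N, hN0, hN⟩ := (hg.isSimpleFn u).exists_abs_le
  have hzX : segPoint x₀ x₁ 0 ∈ X := segPoint_mem hX h₀ h₁ (by simp)
  have huz : u (segPoint x₀ x₁ 0) = 0 := hu.segPoint h₀ h₁ hu₀ hu₁ (by simp)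
  set z := segPoint x₀ x₁ 0
  set α : ℝ := 1 / (M + N + 2) with hα
  have hα0 : 0 < α := by positivity
  have hα1 : α < 1 := by
    rw [hα, div_lt_one (by positivity)]
    linarith
  have hαM : α * (M + N + 2) = 1 := by
    rw [hα]
    field_simp
  have hzA : IsAct X (constAct S z) := isAct_constAct hzX
  have hmA : ∀ p, IsAct X p → IsAct X (mixAct α p (constAct S z)) := fun p hp =>
    hp.mixAct hX hzA hα0.le hα1.le
  have hmu : ∀ p, IsAct X p → ∀ s, u (mixAct α p (constAct S z) s) = α * u (p s) := by
    intro p hp s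
    rw [hu.mixAct hp hzA hα0.le hα1.le]
    simp [constAct, huz]
  rw [A3 f g hf hg z hzX α hα0 hα1] at h
  rw [A3 f' g' hf' hg' z hzX α hα0 hα1]
  obtain ⟨δ, hδ0, hδ1, hδ⟩ := exists_mixAct_pref A2 (hmA f hf) (hmA g hg) h₀ h
  have hx₀A : IsAct X (constAct S x₀) := isAct_constAct h₀
  have hx₁A : IsAct X (constAct S x₁) := isAct_constAct h₁
  have hfδ := hx₀A.mixAct hX (hmA f hf) hδ0.le hδ1.le
  have h2 : R (mixAct α f' (constAct S z)) (mixAct α g (constAct S z)) := by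
    refine A1.2.1 _ _ _ (hmA f' hf') hfδ (hmA g hg) (A5 _ _ (hmA f' hf') hfδ fun s => ?_) hδ
    rw [huR _ ((hmA f' hf').1 s) _ (hfδ.1 s), hu.mixAct hx₀A (hmA f hf) hδ0.le hδ1.le,
      hmu f hf, hmu f' hf', hff']
    simp only [constAct, hu₀]
    have := (abs_le.1 (hM s)).1
    have : 0 < α * u (f s) + 1 := by nlinarith
    nlinarith
  obtain ⟨η, hη0, hη1, hη⟩ := exists_pref_mixAct A2 (hmA f' hf') (hmA g hg) h₁ h2
  have hgη := hx₁A.mixAct hX (hmA g hg) hη0.le hη1.le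
  refine A1.2.1 _ _ _ (hmA f' hf') hgη (hmA g' hg') hη (A5 _ _ hgη (hmA g' hg') fun s => ?_)
  rw [huR _ (hgη.1 s) _ ((hmA g' hg').1 s), hu.mixAct hx₁A (hmA g hg) hη0.le hη1.le,
    hmu g hg, hmu g' hg', hgg']
  simp only [constAct, hu₁]
  have := (abs_le.1 (hN s)).2
  have : 0 < 1 - α * u (g s) := by nlinarith
  nlinarith

/-- The preference is invariant under common positive affine changes of utility profiles. -/
theorem pref_of_utility_affine {X : Set V} (hX : Convex ℝ X)
    {R : (S → V) → (S → V) → Prop} (A1 : PrefAx1 X R) (A2 : PrefAx2 X R) (A3 : PrefAx3 X R)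
    (A5 : PrefAx5 X R) {u : V → ℝ} (hu : IsAffineOn u X)
    (huR : ∀ x ∈ X, ∀ y ∈ X, R (constAct S x) (constAct S y) ↔ u y < u x)
    {x₀ x₁ : V} (h₀ : x₀ ∈ X) (h₁ : x₁ ∈ X) (hu₀ : u x₀ = -1) (hu₁ : u x₁ = 1)
    {f g f' g' : S → V} (hf : IsAct X f) (hg : IsAct X g) (hf' : IsAct X f') (hg' : IsAct X g')
    {k b : ℝ} (hk : 0 < k)
    (hff' : ∀ s, u (f' s) = k * u (f s) + b) (hgg' : ∀ s, u (g' s) = k * u (g s) + b)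
    (h : R f g) : R f' g' := by
  set α : ℝ := 1 / (2 + |b| + k) with hα
  have hb := abs_nonneg b
  have hα0 : 0 < α := by positivity
  have hαe : α * (2 + |b| + k) = 1 := by
    rw [hα]
    field_simp
  have hα1 : α < 1 := by nlinarith
  have hαk0 : 0 < α * k := by positivity
  have hαk1 : α * k < 1 := by nlinarith
  have hzX : segPoint x₀ x₁ 0 ∈ X := segPoint_mem hX h₀ h₁ (by simp)
  have huz : u (segPoint x₀ x₁ 0) = 0 := hu.segPoint h₀ h₁ hu₀ hu₁ (by simp)
  set z := segPoint x₀ x₁ 0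
  have hα1' : 0 < 1 - α := by linarith
  have htabs : |-(α * b) / (1 - α)| ≤ 1 := by
    rw [abs_div, abs_neg, abs_mul, abs_of_pos hα0, abs_of_pos hα1', div_le_one hα1']
    nlinarith
  have hxX : segPoint x₀ x₁ (-(α * b) / (1 - α)) ∈ X := segPoint_mem hX h₀ h₁ htabs
  have hux : u (segPoint x₀ x₁ (-(α * b) / (1 - α))) = -(α * b) / (1 - α) :=
    hu.segPoint h₀ h₁ hu₀ hu₁ htabs
  set x := segPoint x₀ x₁ (-(α * b) / (1 - α))
  have hzA : IsAct X (constAct S z) := isAct_constAct hzX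
  have hxA : IsAct X (constAct S x) := isAct_constAct hxX
  have heq : ∀ p p', IsAct X p → IsAct X p' → (∀ s, u (p' s) = k * u (p s) + b) →
      ∀ s, u (mixAct α p' (constAct S x) s) = u (mixAct (α * k) p (constAct S z) s) := by
    intro p p' hp hp' hpp' s
    rw [hu.mixAct hp' hxA hα0.le hα1.le, hu.mixAct hp hzA hαk0.le hαk1.le, hpp']
    simp only [constAct, huz, hux]
    field_simp
    ring
  rw [A3 f g hf hg z hzX _ hαk0 hαk1] at h
  rw [A3 f' g' hf' hg' x hxX _ hα0 hα1]
  exact pref_of_utility_eq hX A1 A2 A3 A5 hu huR h₀ h₁ hu₀ hu₁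
    (hf.mixAct hX hzA hαk0.le hαk1.le) (hg.mixAct hX hzA hαk0.le hαk1.le)
    (hf'.mixAct hX hxA hα0.le hα1.le) (hg'.mixAct hX hxA hα0.le hα1.le)
    (heq f f' hf hf' hff') (heq g g' hg hg' hgg') h

end Preferences

section Representation

variable {S : Type*} [MeasurableSpace S]
variable {V : Type*} [AddCommGroup V] [Module ℝ V]

theorem exists_normalized_utility {X : Set V} (hX : Convex ℝ X)
    {R : (S → V) → (S → V) → Prop} (A1 : PrefAx1 X R) (A2 : PrefAx2 X R) (A3 : PrefAx3 X R) :
    ∃ u : V → ℝ, IsAffineOn u X ∧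
      (∀ x ∈ X, ∀ y ∈ X, R (constAct S x) (constAct S y) ↔ u y < u x) ∧
      ∃ x₀ ∈ X, ∃ x₁ ∈ X, u x₀ = -1 ∧ u x₁ = 1 := by
  obtain ⟨hasymm, -, ⟨x₁, h₁, x₀, h₀, h₁₀⟩, hneg⟩ := A1
  obtain ⟨u, hu, huR⟩ := exists_affine_utility hX (fun x y => R (constAct S x) (constAct S y))
    (fun x hx y hy => hasymm _ _ (isAct_constAct hx) (isAct_constAct hy)) hneg
    (fun x hx y hy z hz α h0 h1 =>
      A3 _ _ (isAct_constAct hx) (isAct_constAct hy) z hz α h0 h1)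
    (fun x hx y hy z hz =>
      A2 _ _ _ (isAct_constAct hx) (isAct_constAct hy) (isAct_constAct hz)) h₀ h₁ h₁₀
  have hlt := (huR _ h₁ _ h₀).1 h₁₀
  have hd : 0 < u x₁ - u x₀ := by linarith
  refine ⟨fun v => (2 * u v - u x₁ - u x₀) / (u x₁ - u x₀), ?_, ?_, x₀, h₀, x₁, h₁, ?_, ?_⟩
  · intro x hx y hy α h0 h1
    simp only [hu x hx y hy α h0 h1]
    field_simp
    ring
  · intro x hx y hy
    rw [huR x hx y hy, div_lt_div_iff_of_pos_right hd]
    constructor <;> intro h <;> linarith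
  · field_simp
    ring
  · field_simp
    ring

theorem exists_isDualRep [Nonempty S] {X : Set V} (hX : Convex ℝ X)
    {R : (S → V) → (S → V) → Prop} (A1 : PrefAx1 X R) (A2 : PrefAx2 X R) (A3 : PrefAx3 X R)
    (A5 : PrefAx5 X R) (A6 : PrefAx6 X R) (A7 : PrefAx7 X R) :
    ∃ (u : V → ℝ) (Ip Io : (S → ℝ) → ℝ), IsDualRep X R u Ip Io := by
  obtain ⟨u, hu, huR, x₀, h₀, x₁, h₁, hu₀, hu₁⟩ := exists_normalized_utility hX A1 A2 A3
  obtain ⟨Q, hQ⟩ : ∃ Q : (S → ℝ) → (S → ℝ) → Prop, ∀ φ ψ f g, IsAct X f → IsAct X g →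
      ∀ k > 0, ∀ b, (∀ s, φ s = k * u (f s) + b) → (∀ s, ψ s = k * u (g s) + b) →
        (Q φ ψ ↔ R f g) := by
    refine ⟨fun φ ψ => ∃ f g, IsAct X f ∧ IsAct X g ∧ ∃ k > 0, ∃ b,
      (∀ s, φ s = k * u (f s) + b) ∧ (∀ s, ψ s = k * u (g s) + b) ∧ R f g, ?_⟩
    intro φ ψ f g hf hg k hk b hφ hψ
    refine ⟨?_, fun h => ⟨f, g, hf, hg, k, hk, b, hφ, hψ, h⟩⟩
    rintro ⟨f', g', hf', hg', k', hk', b', hφ', hψ', h⟩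
    have key : ∀ p q : ℝ, k * p + b = k' * q + b' → p = k' / k * q + (b' - b) / k := by
      intro p q h
      field_simp
      linarith
    exact pref_of_utility_affine hX A1 A2 A3 A5 hu huR h₀ h₁ hu₀ hu₁ hf' hg' hf hg
      (div_pos hk' hk) (fun s => key _ _ ((hφ s).symm.trans (hφ' s)))
      (fun s => key _ _ ((hψ s).symm.trans (hψ' s))) h
  have hua : ∀ (φ : S → ℝ) (k : ℝ), 0 < k → (∀ s, |φ s| ≤ k) → ∀ s,
      φ s = k * u (segPoint x₀ x₁ (φ s / k)) + 0 := by
    intro φ k hk hb s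
    rw [hu.segPoint h₀ h₁ hu₀ hu₁]
    · field_simp
      ring
    · rw [abs_div, abs_of_pos hk]
      exact (div_le_one hk).2 (hb s)
  have hQa : ∀ φ ψ : S → ℝ, IsSimpleFn φ → IsSimpleFn ψ → ∀ k : ℝ, 0 < k →
      (∀ s, |φ s| ≤ k) → (∀ s, |ψ s| ≤ k) →
      (Q φ ψ ↔ R (fun s => segPoint x₀ x₁ (φ s / k)) (fun s => segPoint x₀ x₁ (ψ s / k))) :=
    fun φ ψ hφ hψ k hk bφ bψ => hQ φ ψ _ _ (isAct_segPoint hX h₀ h₁ hφ hk bφ)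
      (isAct_segPoint hX h₀ h₁ hψ hk bψ) k hk 0 (hua φ k hk bφ) (hua ψ k hk bψ)
  have hbound : ∀ φ ψ χ : S → ℝ, IsSimpleFn φ → IsSimpleFn ψ → IsSimpleFn χ →
      ∃ k : ℝ, 0 < k ∧ (∀ s, |φ s| + 1 ≤ k) ∧ (∀ s, |φ s| ≤ k) ∧ (∀ s, |ψ s| ≤ k) ∧
        ∀ s, |χ s| ≤ k := by
    intro φ ψ χ hφ hψ hχ
    obtain ⟨a, ha, hφ⟩ := hφ.exists_abs_le
    obtain ⟨b, hb, hψ⟩ := hψ.exists_abs_le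
    obtain ⟨c, hc, hχ⟩ := hχ.exists_abs_le
    exact ⟨a + b + c + 1, by positivity, fun s => by linarith [hφ s],
      fun s => by linarith [hφ s], fun s => by linarith [hψ s], fun s => by linarith [hχ s]⟩
  have hA : ∀ {φ : S → ℝ}, IsSimpleFn φ → ∀ {k : ℝ}, 0 < k → (∀ s, |φ s| ≤ k) →
      IsAct X fun s => segPoint x₀ x₁ (φ s / k) := fun hφ _ hk hb =>
    isAct_segPoint hX h₀ h₁ hφ hk hb
  have htrans : ∀ φ ψ χ, IsSimpleFn φ → IsSimpleFn ψ → IsSimpleFn χ → Q φ ψ → Q ψ χ → Q φ χ := by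
    intro φ ψ χ hφ hψ hχ h1 h2
    obtain ⟨k, hk, -, b1, b2, b3⟩ := hbound φ ψ χ hφ hψ hχ
    rw [hQa _ _ hφ hψ k hk b1 b2] at h1
    rw [hQa _ _ hψ hχ k hk b2 b3] at h2
    rw [hQa _ _ hφ hχ k hk b1 b3]
    exact A1.2.1 _ _ _ (hA hφ hk b1) (hA hψ hk b2) (hA hχ hk b3) h1 h2
  have hdom : ∀ φ ψ, IsSimpleFn φ → IsSimpleFn ψ → (∀ s, ψ s < φ s) → Q φ ψ := by
    intro φ ψ hφ hψ h
    obtain ⟨k, hk, -, b1, b2, -⟩ := hbound φ ψ ψ hφ hψ hψ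
    rw [hQa _ _ hφ hψ k hk b1 b2]
    refine A5 _ _ (hA hφ hk b1) (hA hψ hk b2) fun s => ?_
    rw [huR _ ((hA hφ hk b1).1 s) _ ((hA hψ hk b2).1 s)]
    have := h s
    rw [hua φ k hk b1 s, hua ψ k hk b2 s] at this
    exact lt_of_mul_lt_mul_left (by linarith) hk.le
  obtain ⟨Ip, Io, hpm, hom, hpc, hoc, hle, hrep⟩ := exists_dual_functionals Q
    (fun φ ψ hφ hψ h => by
      obtain ⟨k, hk, -, b1, b2, -⟩ := hbound φ ψ ψ hφ hψ hψ
      rw [hQa _ _ hφ hψ k hk b1 b2] at h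
      rw [hQa _ _ hψ hφ k hk b2 b1]
      exact A1.1 _ _ (hA hφ hk b1) (hA hψ hk b2) h)
    htrans hdom
    (fun φ ψ hφ hψ a ha b h => by
      obtain ⟨k, hk, -, b1, b2, -⟩ := hbound φ ψ ψ hφ hψ hψ
      rw [hQa _ _ hφ hψ k hk b1 b2] at h
      refine (hQ _ _ _ _ (hA hφ hk b1) (hA hψ hk b2) (a * k) (mul_pos ha hk) b
        (fun s => ?_) (fun s => ?_)).2 h
      · linear_combination a * hua φ k hk b1 s
      · linear_combination a * hua ψ k hk b2 s)
    (fun φ ψ hφ hψ h => by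
      obtain ⟨k, hk, b0, b1, b2, -⟩ := hbound φ ψ ψ hφ hψ hψ
      rw [hQa _ _ hφ hψ k hk b1 b2] at h
      obtain ⟨δ, hδ0, hδ1, hδ⟩ := exists_mixAct_pref A2 (hA hφ hk b1) (hA hψ hk b2) h₀ h
      have hx₀A : IsAct X (constAct S x₀) := isAct_constAct h₀
      have hm := hx₀A.mixAct hX (hA hφ hk b1) hδ0.le hδ1.le
      rw [← hQ (fun s => k * u (mixAct δ (constAct S x₀)
        (fun s => segPoint x₀ x₁ (φ s / k)) s) + 0) ψ _ _ hm (hA hψ hk b2) k hk 0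
        (fun s => rfl) (hua ψ k hk b2)] at hδ
      have hs : IsSimpleFn fun s => φ s - δ / 2 :=
        finite_measurable_comp hφ fun x => x - δ / 2
      have hms := (hm.isSimpleFn u).affine k 0
      refine ⟨δ / 2, by positivity, htrans _ _ _ hs hms hψ (hdom _ _ hs hms fun s => ?_) hδ⟩
      rw [hu.mixAct hx₀A (hA hφ hk b1) hδ0.le hδ1.le]
      simp only [constAct, hu₀]
      have e := hua φ k hk b1 s
      have e0 := b0 s
      have e1 := neg_abs_le (φ s)
      have e2 : k * (δ * -1 + (1 - δ) * u (segPoint x₀ x₁ (φ s / k))) + 0 =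
          φ s - δ * (k + φ s) := by
        linear_combination -(1 - δ) * e
      rw [e2]
      nlinarith)
    (fun φ ψ hφ hψ h => by
      obtain ⟨k, hk, -, b1, b2, -⟩ := hbound φ ψ ψ hφ hψ hψ
      rw [hQa _ _ hφ hψ k hk b1 b2, hQa _ _ hψ hφ k hk b2 b1]
      refine A6 _ _ (hA hφ hk b1) (hA hψ hk b2) fun x hx hinc => ?_
      have hc : IsAct X (constAct S x) := isAct_constAct hx
      have ht : ∀ s : S, k * u x = k * u (constAct S x s) + 0 := fun s => by simp [constAct]
      have := h (k * u x)
      rw [hQ _ _ _ _ (hA hφ hk b1) hc k hk 0 (hua φ k hk b1) ht,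
        hQ _ _ _ _ hc (hA hφ hk b1) k hk 0 ht (hua φ k hk b1),
        hQ _ _ _ _ (hA hψ hk b2) hc k hk 0 (hua ψ k hk b2) ht,
        hQ _ _ _ _ hc (hA hψ hk b2) k hk 0 ht (hua ψ k hk b2)] at this
      exact this hinc)
    (fun φ ψ hφ hψ t r h1 h2 h3 h4 => by
      obtain ⟨a, ha, -, a1, a2, -⟩ := hbound φ ψ ψ hφ hψ hψ
      set k := a + |t| + |r| with hk'
      have hk : 0 < k := by positivity
      have ht0 := abs_nonneg t
      have hr0 := abs_nonneg r
      have b1 : ∀ s, |φ s| ≤ k := fun s => by linarith [a1 s]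
      have b2 : ∀ s, |ψ s| ≤ k := fun s => by linarith [a2 s]
      have bt : ∀ _ : S, |t| ≤ k := fun s => by linarith
      have br : ∀ _ : S, |r| ≤ k := fun s => by linarith
      have ht := isSimpleFn_const (S := S) t
      have hr := isSimpleFn_const (S := S) r
      rw [hQa _ _ hφ ht k hk b1 bt, hQa _ _ ht hφ k hk bt b1] at h1
      rw [hQa _ _ ht hψ k hk bt b2] at h2
      rw [hQa _ _ hψ hr k hk b2 br, hQa _ _ hr hψ k hk br b2] at h3
      rw [hQa _ _ hφ hr k hk b1 br] at h4
      rw [hQa _ _ hφ hψ k hk b1 b2]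
      obtain ⟨s⟩ := ‹Nonempty S›
      exact A7 _ _ (hA hφ hk b1) (hA hψ hk b2) _ ((hA ht hk bt).1 s) _ ((hA hr hk br).1 s)
        h1 h2 h3 h4)
  refine ⟨u, Ip, Io, hu, ⟨x₀, h₀, x₁, h₁, by rw [hu₀, hu₁]; norm_num⟩, hpm, hom, hpc, hoc,
    fun h hh => hle _ (hh.isSimpleFn u), fun f g hf hg => ?_⟩
  rw [← hrep _ _ (hf.isSimpleFn u) (hg.isSimpleFn u)]
  exact (hQ _ _ f g hf hg 1 one_pos 0 (fun s => by ring) (fun s => by ring)).symm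

/-- Every act has a certainty equivalent for a monotonic constant-linear functional. -/
theorem exists_certainty_equivalent [Nonempty S] {X : Set V} (hX : Convex ℝ X) {u : V → ℝ}
    (hu : IsAffineOn u X) {I : (S → ℝ) → ℝ} (hm : MonotonicFn I) (hc : ConstLinearFn I)
    {f : S → V} (hf : IsAct X f) : ∃ z ∈ X, u z = I fun s => u (f s) := by
  have hs := hf.isSimpleFn u
  obtain ⟨_, ⟨s, rfl⟩, hmin⟩ := Set.exists_min_image _ id hs.1 (Set.range_nonempty _)
  obtain ⟨_, ⟨t, rfl⟩, hmax⟩ := Set.exists_max_image _ id hs.1 (Set.range_nonempty _)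
  refine hu.exists_eq hX (hf.1 s) (hf.1 t) ?_ ?_
  · rw [← hc.const (u (f s))]
    exact hm _ _ (isSimpleFn_const _) hs fun r => hmin _ ⟨r, rfl⟩
  · rw [← hc.const (u (f t))]
    exact hm _ _ hs (isSimpleFn_const _) fun r => hmax _ ⟨r, rfl⟩

theorem lt_of_forall_lt [Nonempty S] {I : (S → ℝ) → ℝ} (hm : MonotonicFn I) (hc : ConstLinearFn I)
    {φ ψ : S → ℝ} (hφ : IsSimpleFn φ) (hψ : IsSimpleFn ψ) (h : ∀ s, ψ s < φ s) : I ψ < I φ := by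
  have hd : IsSimpleFn fun s => φ s - ψ s := finite_measurable_map₂ hφ hψ fun x y => x - y
  obtain ⟨_, ⟨s, rfl⟩, hmin⟩ := Set.exists_min_image _ id hd.1 (Set.range_nonempty _)
  have h1 := hc _ hψ 1 zero_le_one (φ s - ψ s)
  have h2 := hm _ _ (hψ.affine 1 (φ s - ψ s)) hφ fun r => by
    have : φ s - ψ s ≤ φ r - ψ r := hmin _ ⟨r, rfl⟩
    linarith
  linarith [h s]

namespace IsDualRep

variable {X : Set V} {R : (S → V) → (S → V) → Prop} {u : V → ℝ} {Ip Io : (S → ℝ) → ℝ}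

theorem pref_const_iff (h : IsDualRep X R u Ip Io) {f : S → V} (hf : IsAct X f) {x : V}
    (hx : x ∈ X) : R f (constAct S x) ↔ u x < Ip fun s => u (f s) := by
  obtain ⟨-, -, -, -, hpc, hoc, hle, hR⟩ := h
  rw [hR _ _ hf (isAct_constAct hx)]
  simp only [constAct, hpc.const, hoc.const]
  exact ⟨fun h => h.1, fun h => ⟨h, h.trans_le (hle f hf)⟩⟩

theorem const_pref_iff (h : IsDualRep X R u Ip Io) {f : S → V} (hf : IsAct X f) {x : V}
    (hx : x ∈ X) : R (constAct S x) f ↔ (Io fun s => u (f s)) < u x := by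
  obtain ⟨-, -, -, -, hpc, hoc, hle, hR⟩ := h
  rw [hR _ _ (isAct_constAct hx) hf]
  simp only [constAct, hpc.const, hoc.const]
  exact ⟨fun h => h.2, fun h => ⟨(hle f hf).trans_lt h, h⟩⟩

theorem const_pref_const_iff (h : IsDualRep X R u Ip Io) {x y : V} (hx : x ∈ X) (hy : y ∈ X) :
    R (constAct S x) (constAct S y) ↔ u y < u x := by
  rw [h.pref_const_iff (isAct_constAct hx) hy]
  simp only [constAct, h.2.2.2.2.1.const]

theorem satisfies_prefAx [Nonempty S] (hX : Convex ℝ X) (h : IsDualRep X R u Ip Io) :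
    PrefAx1 X R ∧ PrefAx2 X R ∧ PrefAx3 X R ∧ PrefAx5 X R ∧ PrefAx6 X R ∧ PrefAx7 X R := by
  have hcc := fun {x y : V} => h.const_pref_const_iff (x := x) (y := y)
  have hfc := fun {f : S → V} (hf : IsAct X f) {x : V} => h.pref_const_iff hf (x := x)
  have hcf := fun {f : S → V} (hf : IsAct X f) {x : V} => h.const_pref_iff hf (x := x)
  obtain ⟨hu, hnc, hpm, hom, hpc, hoc, hle, hR⟩ := h
  refine ⟨⟨?_, ?_, ?_, ?_⟩, ?_, ?_, ?_, ?_, ?_⟩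
  · intro f g hf hg h1 h2
    rw [hR _ _ hf hg] at h1
    rw [hR _ _ hg hf] at h2
    exact lt_asymm h1.1 h2.1
  · intro f g k hf hg hk h1 h2
    rw [hR _ _ hf hg] at h1
    rw [hR _ _ hg hk] at h2
    rw [hR _ _ hf hk]
    exact ⟨h2.1.trans h1.1, h2.2.trans h1.2⟩
  · obtain ⟨x, hx, y, hy, hxy⟩ := hnc
    rcases lt_or_gt_of_ne hxy with h | h
    · exact ⟨y, hy, x, hx, (hcc hy hx).2 h⟩
    · exact ⟨x, hx, y, hy, (hcc hx hy).2 h⟩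
  · intro x hx y hy z hz h1 h2
    rw [hcc hx hy] at h1
    rw [hcc hy hz] at h2
    rw [hcc hx hz]
    linarith
  · intro f g k hf hg hk
    have hcont : ∀ I : (S → ℝ) → ℝ, MonotonicFn I → ConstLinearFn I →
        Continuous fun α : Set.Icc (0 : ℝ) 1 => I fun s => u (mixAct (α : ℝ) f g s) := by
      intro I hm hc
      have := (continuous_mix_of_monotonicFn hm hc (hf.isSimpleFn u) (hg.isSimpleFn u)).comp
        (continuous_subtype_val (p := (· ∈ Set.Icc (0 : ℝ) 1)))
      convert this using 2 with α
      exact congrArg I (funext fun s => hu.mixAct hf hg α.2.1 α.2.2 s)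
    have hp := hcont Ip hpm hpc
    have ho := hcont Io hom hoc
    constructor
    · convert (isOpen_lt continuous_const hp).inter (isOpen_lt continuous_const ho) using 1
      ext α
      exact hR _ _ (hf.mixAct hX hg α.2.1 α.2.2) hk
    · convert (isOpen_lt hp continuous_const).inter (isOpen_lt ho continuous_const) using 1
      ext α
      exact hR _ _ hk (hf.mixAct hX hg α.2.1 α.2.2)
  · intro f g hf hg x hx α h0 h1
    have hxA : IsAct X (constAct S x) := isAct_constAct hx
    have hmix : ∀ I : (S → ℝ) → ℝ, ConstLinearFn I → ∀ p, IsAct X p →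
        (I fun s => u (mixAct α p (constAct S x) s)) =
          α * (I fun s => u (p s)) + (1 - α) * u x := by
      intro I hc p hp
      rw [← hc _ (hp.isSimpleFn u) α h0.le]
      exact congrArg I (funext fun s => hu.mixAct hp hxA h0.le h1.le s)
    rw [hR _ _ hf hg, hR _ _ (hf.mixAct hX hxA h0.le h1.le) (hg.mixAct hX hxA h0.le h1.le),
      hmix _ hpc _ hf, hmix _ hpc _ hg, hmix _ hoc _ hf, hmix _ hoc _ hg]
    simp [h0]
  · intro f g hf hg h
    have hlt : ∀ s, u (g s) < u (f s) := fun s => (hcc (hf.1 s) (hg.1 s)).1 (h s)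
    exact (hR _ _ hf hg).2 ⟨lt_of_forall_lt hpm hpc (hf.isSimpleFn u) (hg.isSimpleFn u) hlt,
      lt_of_forall_lt hom hoc (hf.isSimpleFn u) (hg.isSimpleFn u) hlt⟩
  · intro f g hf hg h
    obtain ⟨x, hx, hxe⟩ := exists_certainty_equivalent hX hu hpm hpc hf
    obtain ⟨y, hy, hye⟩ := exists_certainty_equivalent hX hu hom hoc hf
    have hx' := h x hx
    have hy' := h y hy
    have := hle f hf
    simp only [Incomp, hfc hf hx, hcf hf hx, hfc hg hx, hcf hg hx, not_lt] at hx'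
    simp only [Incomp, hfc hf hy, hcf hf hy, hfc hg hy, hcf hg hy, not_lt] at hy'
    have h1 := (hx' ⟨hxe.ge, by linarith⟩).1
    have h2 := (hy' ⟨by linarith, hye.le⟩).2
    rw [Incomp, hR _ _ hf hg, hR _ _ hg hf]
    exact ⟨fun h => by linarith [h.2], fun h => by linarith [h.1]⟩
  · intro f g hf hg x hx y hy h1 h2 h3 h4
    rw [Incomp, hfc hf hx, hcf hf hx, not_lt, not_lt] at h1
    rw [Incomp, hfc hg hy, hcf hg hy, not_lt, not_lt] at h3
    rw [hcf hg hx] at h2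
    rw [hfc hf hy] at h4
    exact (hR _ _ hf hg).2 ⟨by linarith, by linarith⟩

theorem exists_lt (h : IsDualRep X R u Ip Io) : ∃ x ∈ X, ∃ y ∈ X, u x < u y := by
  obtain ⟨x, hx, y, hy, hxy⟩ := h.2.1
  rcases lt_or_gt_of_ne hxy with h | h
  · exact ⟨x, hx, y, hy, h⟩
  · exact ⟨y, hy, x, hx, h⟩

theorem utility_unique (hX : Convex ℝ X) {u' : V → ℝ} {Ip' Io' : (S → ℝ) → ℝ}
    (h : IsDualRep X R u Ip Io) (h' : IsDualRep X R u' Ip' Io') :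
    ∃ a : ℝ, 0 < a ∧ ∃ b : ℝ, ∀ x ∈ X, u' x = a * u x + b := by
  have hlt : ∀ x ∈ X, ∀ y ∈ X, (u x < u y ↔ u' x < u' y) := fun x hx y hy => by
    rw [← h.const_pref_const_iff hy hx, ← h'.const_pref_const_iff hy hx]
  have heq : ∀ x ∈ X, ∀ y ∈ X, u x = u y → u' x = u' y := by
    intro x hx y hy hxy
    refine le_antisymm (not_lt.1 fun hl => ?_) (not_lt.1 fun hl => ?_)
    · exact ((hlt y hy x hx).2 hl).ne' hxy
    · exact ((hlt x hx y hy).2 hl).ne hxy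
  have hdet : ∀ p ∈ X, ∀ q ∈ X, ∀ r ∈ X, u p ≤ u q → u q ≤ u r →
      (u q - u p) * (u' r - u' p) = (u' q - u' p) * (u r - u p) := by
    intro p hp q hq r hr hpq hqr
    rcases (hpq.trans hqr).eq_or_lt with hpr | hpr
    · rw [heq p hp r hr hpr, heq q hq r hr (by linarith), hpr]
      ring
    · have hd : 0 < u r - u p := by linarith
      have h0 : 0 ≤ (u q - u p) / (u r - u p) := div_nonneg (by linarith) hd.le
      have h1 : (u q - u p) / (u r - u p) ≤ 1 := (div_le_one hd).2 (by linarith)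
      have hz := hX hr hp h0 (sub_nonneg.2 h1) (by ring)
      have e : u q = u (((u q - u p) / (u r - u p)) • r + (1 - (u q - u p) / (u r - u p)) • p) := by
        rw [h.1 r hr p hp _ h0 h1]
        field_simp
        ring
      have e' := heq _ hq _ hz e
      rw [h'.1 r hr p hp _ h0 h1] at e'
      field_simp at e'
      linear_combination -e'
  obtain ⟨x₀, h₀, x₁, h₁, h₀₁⟩ := h.exists_lt
  have hd : 0 < u x₁ - u x₀ := by linarith
  have hd' : 0 < u' x₁ - u' x₀ := by linarith [(hlt _ h₀ _ h₁).1 h₀₁]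
  refine ⟨(u' x₁ - u' x₀) / (u x₁ - u x₀), div_pos hd' hd,
    u' x₀ - (u' x₁ - u' x₀) / (u x₁ - u x₀) * u x₀, fun x hx => ?_⟩
  have key : (u x - u x₀) * (u' x₁ - u' x₀) = (u' x - u' x₀) * (u x₁ - u x₀) := by
    rcases le_total (u x) (u x₀) with hx0 | hx0
    · linear_combination -hdet x hx x₀ h₀ x₁ h₁ hx0 h₀₁.le
    · rcases le_total (u x) (u x₁) with hx1 | hx1
      · exact hdet x₀ h₀ x hx x₁ h₁ hx0 hx1
      · linear_combination -hdet x₀ h₀ x₁ h₁ x hx h₀₁.le hx1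
  field_simp
  linear_combination -key

theorem congr_utility {u' : V → ℝ} (h' : IsDualRep X R u' Ip Io) (hu : IsAffineOn u X)
    (hnc : NonConstOn u X) {a b : ℝ} (ha : 0 < a) (hab : ∀ x ∈ X, u' x = a * u x + b) :
    IsDualRep X R u Ip Io := by
  obtain ⟨-, -, hpm, hom, hpc, hoc, hle, hR⟩ := h'
  have key : ∀ I : (S → ℝ) → ℝ, ConstLinearFn I → ∀ f, IsAct X f →
      (I fun s => u' (f s)) = a * (I fun s => u (f s)) + b := by
    intro I hc f hf
    rw [← hc _ (hf.isSimpleFn u) a ha.le]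
    exact congrArg I (funext fun s => hab _ (hf.1 s))
  refine ⟨hu, hnc, hpm, hom, hpc, hoc, fun f hf => ?_, fun f g hf hg => ?_⟩
  · have := hle f hf
    rw [key _ hpc _ hf, key _ hoc _ hf] at this
    exact le_of_mul_le_mul_left (by linarith) ha
  · rw [hR _ _ hf hg, key _ hpc _ hf, key _ hoc _ hf, key _ hpc _ hg, key _ hoc _ hg]
    simp [ha]

theorem functionals_unique [Nonempty S] (hX : Convex ℝ X) {Ip' Io' : (S → ℝ) → ℝ}
    (h : IsDualRep X R u Ip Io) (h' : IsDualRep X R u Ip' Io') {φ : S → ℝ}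
    (hφ : IsSimpleFn φ) : Ip' φ = Ip φ ∧ Io' φ = Io φ := by
  have hp : ∀ f, IsAct X f → (Ip' fun s => u (f s)) = Ip fun s => u (f s) := by
    intro f hf
    obtain ⟨z, hz, hze⟩ := exists_certainty_equivalent hX h.1 h.2.2.1 h.2.2.2.2.1 hf
    obtain ⟨y, hy, hye⟩ := exists_certainty_equivalent hX h.1 h'.2.2.1 h'.2.2.2.2.1 hf
    have h1 := (h.pref_const_iff hf hz).symm.trans (h'.pref_const_iff hf hz)
    have h2 := (h.pref_const_iff hf hy).symm.trans (h'.pref_const_iff hf hy)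
    rw [hze] at h1
    rw [hye] at h2
    exact le_antisymm (not_lt.1 fun h => lt_irrefl _ (h1.2 h))
      (not_lt.1 fun h => lt_irrefl _ (h2.1 h))
  have ho : ∀ f, IsAct X f → (Io' fun s => u (f s)) = Io fun s => u (f s) := by
    intro f hf
    obtain ⟨z, hz, hze⟩ := exists_certainty_equivalent hX h.1 h.2.2.2.1 h.2.2.2.2.2.1 hf
    obtain ⟨y, hy, hye⟩ := exists_certainty_equivalent hX h.1 h'.2.2.2.1 h'.2.2.2.2.2.1 hf
    have h1 := (h.const_pref_iff hf hz).symm.trans (h'.const_pref_iff hf hz)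
    have h2 := (h.const_pref_iff hf hy).symm.trans (h'.const_pref_iff hf hy)
    rw [hze] at h1
    rw [hye] at h2
    exact le_antisymm (not_lt.1 fun h => lt_irrefl _ (h2.1 h))
      (not_lt.1 fun h => lt_irrefl _ (h1.2 h))
  obtain ⟨x₀, h₀, x₁, h₁, h₀₁⟩ := h.exists_lt
  obtain ⟨M, hM0, hM⟩ := hφ.exists_abs_le
  have hk : 0 < M + 1 := by linarith
  have hb : ∀ s, |φ s| ≤ M + 1 := fun s => (hM s).trans (by linarith)
  have hA := isAct_segPoint hX h₀ h₁ hφ hk hb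
  have hd : 0 < u x₁ - u x₀ := by linarith
  set a := 2 * (M + 1) / (u x₁ - u x₀) with ha
  have ha0 : 0 < a := by positivity
  have hrep : φ = fun s => a * u (segPoint x₀ x₁ (φ s / (M + 1))) +
      -(a * ((u x₁ + u x₀) / 2)) := by
    ext s
    have ht : |φ s / (M + 1)| ≤ 1 := by
      rw [abs_div, abs_of_pos hk]
      exact (div_le_one hk).2 (hb s)
    obtain ⟨t0, t1⟩ := abs_le.1 ht
    rw [segPoint, h.1 _ h₁ _ h₀ _ (by linarith) (by linarith), ha]
    field_simp
    ring
  obtain ⟨-, -, -, -, hpc, hoc, -, -⟩ := h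
  obtain ⟨-, -, -, -, hpc', hoc', -, -⟩ := h'
  have hs := hA.isSimpleFn u
  rw [hrep, hpc _ hs a ha0.le, hoc _ hs a ha0.le, hpc' _ hs a ha0.le, hoc' _ hs a ha0.le,
    hp _ hA, ho _ hA]
  exact ⟨rfl, rfl⟩

end IsDualRep

end Representation

section Statement

variable {S : Type*} [MeasurableSpace S] [Nonempty S]
variable {V : Type*} [AddCommGroup V] [Module ℝ V]

/-- Theorem 4, intermediary representation: `≻` satisfies
Axioms 1, 2, 3, 5, 6 and 7 iff it admits a dual representation `(u, Ip, Io)`;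
moreover `u` is unique up to positive affine transformation and `(Ip, Io)`
is unique (on `B₀(Σ)`). -/
theorem statement3 (X : Set V) (hX : Convex ℝ X) (hX2 : ∃ x ∈ X, ∃ y ∈ X, x ≠ y)
    (R : (S → V) → (S → V) → Prop) :
    ((PrefAx1 X R ∧ PrefAx2 X R ∧ PrefAx3 X R ∧ PrefAx5 X R ∧
        PrefAx6 X R ∧ PrefAx7 X R) ↔
      ∃ (u : V → ℝ) (Ip Io : (S → ℝ) → ℝ), IsDualRep X R u Ip Io) ∧
    (∀ (u u' : V → ℝ) (Ip Io Ip' Io' : (S → ℝ) → ℝ),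
      IsDualRep X R u Ip Io → IsDualRep X R u' Ip' Io' →
      ((∃ a : ℝ, 0 < a ∧ ∃ b : ℝ, ∀ x ∈ X, u' x = a * u x + b) ∧
        (∀ φ, IsSimpleFn φ → Ip' φ = Ip φ ∧ Io' φ = Io φ))) := by
  refine ⟨⟨fun ⟨A1, A2, A3, A5, A6, A7⟩ => exists_isDualRep hX A1 A2 A3 A5 A6 A7,
    fun ⟨u, Ip, Io, h⟩ => h.satisfies_prefAx hX⟩, fun u u' Ip Io Ip' Io' h h' => ?_⟩
  obtain ⟨a, ha, b, hab⟩ := h.utility_unique hX h'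
  exact ⟨⟨a, ha, b, hab⟩, fun φ hφ =>
    h.functionals_unique hX (h'.congr_utility h.1 h.2.1 ha hab) hφ⟩

end Statement
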